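/- For every integer m ≥ 1 and every ε > 0 there exists a digraph D with clique number ω(D) = m such that h(D) > m/(m+1) − ε. -/

import Mathlib

namespace HatProblem

variable {V : Type*} [Fintype V] [DecidableEq V]

/-- A team strategy: each vertex maps a full configuration to a guess (`none` = pass),
depending only on the colors of its out-neighbors. -/
def IsStrategy (A : V → V → Prop) (S : V → (V → Bool) → Option Bool) : Prop :=
  ∀ (v : V) (c c' : V → Bool), (∀ u, A v u → c u = c' u) → S v c = S v c'

/-- The team wins at configuration `c`: someone guesses correctly, nobody guesses wrong. -/
def Wins (S : V → (V → Bool) → Option Bool) (c : V → Bool) : Prop :=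
  (∃ v, S v c = some (c v)) ∧ ∀ v b, S v c = some b → b = c v

/-- The chance of success of a strategy. -/
noncomputable def chance (S : V → (V → Bool) → Option Bool) : ℚ :=
  ({c : V → Bool | Wins S c}.ncard : ℚ) / 2 ^ Fintype.card V

/-- The hat number of a digraph: the maximal chance of success over all strategies. -/
noncomputable def hatNumber (A : V → V → Prop) : ℚ :=
  haveI : Fintype {S : V → (V → Bool) → Option Bool // IsStrategy A S} :=
    Fintype.ofFinite _
  Finset.sup' (Finset.univ : Finset {S : V → (V → Bool) → Option Bool // IsStrategy A S})
    ⟨⟨fun _ _ => none, fun _ _ _ _ => rfl⟩, Finset.mem_univ _⟩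
    fun S => chance S.1

/-- A clique in the skeleton of a digraph: vertices pairwise joined by arcs both ways. -/
def IsDiClique (A : V → V → Prop) (s : Finset V) : Prop :=
  ∀ x ∈ s, ∀ y ∈ s, x ≠ y → A x y ∧ A y x

/-- The clique number of a digraph: the clique number of its skeleton. -/
noncomputable def cliqueNum (A : V → V → Prop) : ℕ :=
  sSup {n | ∃ s : Finset V, IsDiClique A s ∧ s.card = n}

/-- The directed union `C → D` of two digraphs. -/
def dUnion {W : Type*} (A : V → V → Prop) (B : W → W → Prop) :
    V ⊕ W → V ⊕ W → Prop
  | Sum.inl x, Sum.inl y => A x y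
  | Sum.inl _, Sum.inr _ => True
  | Sum.inr _, Sum.inl _ => False
  | Sum.inr x, Sum.inr y => B x y

/-- The complete digraph on `m` vertices. -/
def completeArc (m : ℕ) : Fin m → Fin m → Prop := fun a b => a ≠ b

end HatProblem

namespace HatProblem

/-- Every vertex passes at the configuration `c`. -/
def Silent {V : Type*} (S : V → (V → Bool) → Option Bool) (c : V → Bool) : Prop :=
  ∀ v, S v c = none

open Classical in
/-- The strategy on a directed union where the left part, which sees the right part, plays `T`
when the right part is silent under `S`, and passes otherwise. -/
noncomputable def unionStrategy {V W : Type*} (T : V → (V → Bool) → Option Bool)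
    (S : W → (W → Bool) → Option Bool) : V ⊕ W → (V ⊕ W → Bool) → Option Bool
  | Sum.inl v, c => if Silent S (c ∘ Sum.inr) then T v (c ∘ Sum.inl) else none
  | Sum.inr w, c => S w (c ∘ Sum.inr)

open Classical in
/-- The strategy in which a vertex guesses red exactly when it sees only blue. -/
noncomputable def soloStrategy (V : Type*) (v : V) (c : V → Bool) : Option Bool :=
  if ∀ u, u ≠ v → c u = false then some true else none

section Union

variable {V W : Type*} {A : V → V → Prop} {B : W → W → Prop}
  {T : V → (V → Bool) → Option Bool} {S : W → (W → Bool) → Option Bool}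

lemma IsStrategy.union (hT : IsStrategy A T) (hS : IsStrategy B S) :
    IsStrategy (dUnion A B) (unionStrategy T S) := by
  rintro (v | w) c c' h
  · have hr : c ∘ Sum.inr = c' ∘ Sum.inr := funext fun w => h (Sum.inr w) trivial
    have hl : T v (c ∘ Sum.inl) = T v (c' ∘ Sum.inl) :=
      hT v _ _ fun u hu => h (Sum.inl u) hu
    unfold unionStrategy
    simp only [hl]
    rw [hr]
  · exact hS w _ _ fun u hu => h (Sum.inr u) hu

lemma silent_unionStrategy (c : V ⊕ W → Bool) :
    Silent (unionStrategy T S) c ↔ Silent T (c ∘ Sum.inl) ∧ Silent S (c ∘ Sum.inr) := by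
  constructor
  · intro h
    have hr : Silent S (c ∘ Sum.inr) := fun w => h (Sum.inr w)
    exact ⟨fun v => by simpa [unionStrategy, hr] using h (Sum.inl v), hr⟩
  · rintro ⟨hl, hr⟩ (v | w)
    · simpa [unionStrategy, hr] using hl v
    · exact hr w

lemma Wins.not_silent {c : V → Bool} (h : Wins T c) : ¬ Silent T c := by
  obtain ⟨⟨v, hv⟩, -⟩ := h
  intro hs
  simp [hs v] at hv

lemma wins_unionStrategy (c : V ⊕ W → Bool) :
    Wins (unionStrategy T S) c ↔
      Wins S (c ∘ Sum.inr) ∨ Wins T (c ∘ Sum.inl) ∧ Silent S (c ∘ Sum.inr) := by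
  by_cases hs : Silent S (c ∘ Sum.inr)
  · have hw : ¬ Wins S (c ∘ Sum.inr) := fun h => h.not_silent hs
    have hs' : ∀ w, S w (c ∘ Sum.inr) = none := hs
    simp [Wins, unionStrategy, hs, hs']
  · simp [Wins, unionStrategy, hs]

lemma ncard_silent_unionStrategy :
    {c | Silent (unionStrategy T S) c}.ncard = {c | Silent T c}.ncard * {c | Silent S c}.ncard := by
  rw [← Set.ncard_prod]
  have : {c | Silent (unionStrategy T S) c} =
      Equiv.sumArrowEquivProdArrow V W Bool ⁻¹' ({c | Silent T c} ×ˢ {c | Silent S c}) := by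
    ext c
    exact silent_unionStrategy c
  rw [this]
  exact Set.ncard_preimage_of_injective_subset_range (Equiv.injective _) (by simp)

lemma ncard_wins_unionStrategy [Fintype V] [Fintype W] :
    {c | Wins (unionStrategy T S) c}.ncard =
      2 ^ Fintype.card V * {c | Wins S c}.ncard + {c | Wins T c}.ncard * {c | Silent S c}.ncard := by
  classical
  have : {c | Wins (unionStrategy T S) c} = Equiv.sumArrowEquivProdArrow V W Bool ⁻¹'
      ((Set.univ ×ˢ {c | Wins S c}) ∪ ({c | Wins T c} ×ˢ {c | Silent S c})) := by
    ext c
    simpa [Equiv.sumArrowEquivProdArrow] using wins_unionStrategy c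
  rw [this, Set.ncard_preimage_of_injective_subset_range (Equiv.injective _) (by simp),
    Set.ncard_union_eq, Set.ncard_prod, Set.ncard_prod, Set.ncard_univ]
  · simp
  · rw [Set.disjoint_left]
    rintro ⟨a, b⟩ ⟨-, h⟩ ⟨-, h'⟩
    exact Wins.not_silent h h'

lemma IsDiClique.card_le_of_dUnion {m : ℕ} (hA : ∀ s, IsDiClique A s → s.card ≤ m)
    (hB : ∀ s, IsDiClique B s → s.card ≤ m) {s : Finset (V ⊕ W)}
    (hs : IsDiClique (dUnion A B) s) : s.card ≤ m := by
  have hl : s.toLeft.card ≤ m := hA _ fun x hx y hy hxy =>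
    hs (Sum.inl x) (by simpa using hx) (Sum.inl y) (by simpa using hy) (by simpa using hxy)
  have hr : s.toRight.card ≤ m := hB _ fun x hx y hy hxy =>
    hs (Sum.inr x) (by simpa using hx) (Sum.inr y) (by simpa using hy) (by simpa using hxy)
  have hlr : s.toLeft = ∅ ∨ s.toRight = ∅ := by
    by_contra! h
    obtain ⟨⟨x, hx⟩, y, hy⟩ := h
    exact (hs (Sum.inl x) (by simpa using hx) (Sum.inr y) (by simpa using hy) (by simp)).2
  rw [← Finset.card_toLeft_add_card_toRight]
  rcases hlr with h | h <;> simpa [h]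

lemma irreflexive_dUnion (hA : Irreflexive A) (hB : Irreflexive B) :
    Irreflexive (dUnion A B) := by
  rintro (v | w)
  · exact hA v
  · exact hB w

end Union

section Solo

variable {V : Type*}

lemma soloStrategy_eq_some {v : V} {c : V → Bool} {b : Bool} :
    soloStrategy V v c = some b ↔ (∀ u, u ≠ v → c u = false) ∧ b = true := by
  rw [soloStrategy]
  split_ifs with h
  · rw [Option.some.injEq, and_iff_right h, eq_comm]
  · simp [h]

lemma isStrategy_soloStrategy : IsStrategy (fun a b : V => a ≠ b) (soloStrategy V) := by
  intro v c c' h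
  have : (∀ u, u ≠ v → c u = false) ↔ ∀ u, u ≠ v → c' u = false :=
    forall_congr' fun u => imp_congr_right fun hu => by rw [h u hu.symm]
  unfold soloStrategy
  split_ifs <;> tauto

variable [DecidableEq V]

lemma forall_ne_iff_mem {v : V} {c : V → Bool} :
    (∀ u, u ≠ v → c u = false) ↔
      c = (fun _ => false) ∨ c = Function.update (fun _ => false) v true := by
  constructor
  · intro h
    cases hv : c v
    · left
      funext u
      by_cases hu : u = v <;> simp_all
    · right
      rw [Function.eq_update_iff]
      exact ⟨hv, h⟩
  · rintro (rfl | rfl) u hu <;> simp [hu]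

lemma wins_soloStrategy {c : V → Bool} :
    Wins (soloStrategy V) c ↔
      c ∈ Set.range fun v : V => Function.update (fun _ : V => false) v true := by
  constructor
  · rintro ⟨⟨v, hv⟩, -⟩
    obtain ⟨h, hcv⟩ := soloStrategy_eq_some.1 hv
    refine ⟨v, ?_⟩
    rw [eq_comm, Function.eq_update_iff]
    exact ⟨hcv, h⟩
  · rintro ⟨v, rfl⟩
    refine ⟨⟨v, soloStrategy_eq_some.2 ⟨fun u hu => by simp [hu], by simp⟩⟩, fun w b hw => ?_⟩
    obtain ⟨h, rfl⟩ := soloStrategy_eq_some.1 hw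
    by_cases hvw : v = w
    · simp [hvw]
    · simpa using h v hvw

lemma injective_update_true :
    Function.Injective fun v : V => Function.update (fun _ : V => false) v true := by
  intro v w h
  by_contra hvw
  have := congrFun h v
  simp [hvw] at this

variable [Fintype V]

lemma ncard_wins_soloStrategy : {c | Wins (soloStrategy V) c}.ncard = Fintype.card V := by
  simp only [wins_soloStrategy, Set.ofPred_mem_eq]
  rw [← Set.image_univ, Set.ncard_image_of_injective _ injective_update_true, Set.ncard_univ,
    Nat.card_eq_fintype_card]

lemma ncard_silent_soloStrategy [Nonempty V] :
    {c | Silent (soloStrategy V) c}.ncard + (Fintype.card V + 1) = 2 ^ Fintype.card V := by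
  have h : {c | Silent (soloStrategy V) c} =
      (insert (fun _ => false) {c | Wins (soloStrategy V) c})ᶜ := by
    ext c
    simp only [Silent, Set.mem_ofPred_eq, Set.mem_compl_iff, Set.mem_insert_iff, wins_soloStrategy,
      Option.eq_none_iff_forall_ne_some, ne_eq, soloStrategy_eq_some, forall_ne_iff_mem,
      Set.mem_range]
    constructor
    · intro hc
      have hc' : ∀ v, c ≠ (fun _ => false) ∧ c ≠ Function.update (fun _ => false) v true := by
        simpa using hc
      rintro (h | ⟨v, h⟩)
      · exact (hc' (Classical.arbitrary V)).1 h
      · exact (hc' v).2 h.symm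
    · rintro hc v b ⟨h | h, -⟩
      · exact hc (Or.inl h)
      · exact hc (Or.inr ⟨v, h.symm⟩)
  have h0 : (fun _ => false) ∉ {c | Wins (soloStrategy V) c} := by
    rw [Set.mem_ofPred_eq, wins_soloStrategy]
    rintro ⟨v, hv⟩
    simpa using congrFun hv v
  rw [h, ← ncard_wins_soloStrategy, ← Set.ncard_insert_of_notMem h0, add_comm,
    Set.ncard_add_ncard_compl]
  simp [ncard_wins_soloStrategy]

end Solo

/-- Directed unions of `k` complete digraphs on `m` vertices, with the fractions of winning and
silent configurations of a strategy. -/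
lemma exists_iterated_union (m : ℕ) (hm : 1 ≤ m) (k : ℕ) :
    ∃ (V : Type) (_ : Fintype V) (A : V → V → Prop) (S : V → (V → Bool) → Option Bool),
      Irreflexive A ∧ (∀ s, IsDiClique A s → s.card ≤ m) ∧
      (0 < k → ∃ s, IsDiClique A s ∧ s.card = m) ∧ IsStrategy A S ∧
      (m + 1 : ℚ) * {c | Wins S c}.ncard + m * {c | Silent S c}.ncard
        = m * 2 ^ Fintype.card V ∧
      ({c | Silent S c}.ncard : ℚ) = (1 - (m + 1) / 2 ^ m) ^ k * 2 ^ Fintype.card V := by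
  induction k with
  | zero =>
    refine ⟨Empty, inferInstance, fun _ _ => False, fun _ _ => none, fun v => v.elim,
      fun s _ => by simp [Finset.eq_empty_of_isEmpty s], by simp, fun v => v.elim, ?_, ?_⟩ <;>
    simp [Wins, Silent]
  | succ k ih =>
    obtain ⟨V, _, A, S, hirr, hle, -, hS, hW, hQ⟩ := ih
    have : Nonempty (Fin m) := ⟨⟨0, hm⟩⟩
    have hs := ncard_silent_soloStrategy (V := Fin m)
    rw [Fintype.card_fin] at hs
    have hs' : ({c | Silent (soloStrategy (Fin m)) c}.ncard : ℚ) = 2 ^ m - (m + 1) := by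
      rw [eq_sub_iff_add_eq]
      exact_mod_cast hs
    refine ⟨Fin m ⊕ V, inferInstance, dUnion (completeArc m) A,
      unionStrategy (soloStrategy (Fin m)) S,
      irreflexive_dUnion (fun _ h => h rfl) hirr,
      fun s hs => hs.card_le_of_dUnion (fun t _ => by simpa using t.card_le_univ) hle,
      fun _ => ⟨Finset.univ.map Function.Embedding.inl, ?_, by simp⟩,
      isStrategy_soloStrategy.union hS, ?_, ?_⟩
    · intro x hx y hy hxy
      simp only [Finset.mem_map, Finset.mem_univ, true_and, Function.Embedding.inl_apply] at hx hy
      obtain ⟨a, rfl⟩ := hx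
      obtain ⟨b, rfl⟩ := hy
      have hab : a ≠ b := fun h => hxy (by rw [h])
      exact ⟨hab, hab.symm⟩
    · rw [ncard_wins_unionStrategy, ncard_silent_unionStrategy, ncard_wins_soloStrategy]
      push_cast
      rw [hs', Fintype.card_sum, Fintype.card_fin, pow_add]
      linear_combination (2 : ℚ) ^ m * hW
    · rw [ncard_silent_unionStrategy]
      push_cast
      rw [hs', hQ, Fintype.card_sum, Fintype.card_fin, pow_add, pow_succ]
      have hp : (1 - (m + 1) / 2 ^ m : ℚ) * 2 ^ m = 2 ^ m - (m + 1) := by field_simp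
      rw [← hp]
      ring

lemma cliqueNum_eq {V : Type*} {A : V → V → Prop} {m : ℕ}
    (hle : ∀ s, IsDiClique A s → s.card ≤ m) (hex : ∃ s, IsDiClique A s ∧ s.card = m) :
    cliqueNum A = m := by
  refine IsGreatest.csSup_eq ⟨hex, ?_⟩
  rintro n ⟨s, hs, rfl⟩
  exact hle s hs

lemma chance_le_hatNumber {V : Type*} [Fintype V] [DecidableEq V] {A : V → V → Prop}
    {S : V → (V → Bool) → Option Bool} (hS : IsStrategy A S) : chance S ≤ hatNumber A := by
  let := Fintype.ofFinite {S : V → (V → Bool) → Option Bool // IsStrategy A S}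
  exact Finset.le_sup' (f := fun S : {S : V → (V → Bool) → Option Bool // IsStrategy A S} =>
    chance S.1) (b := ⟨S, hS⟩) (Finset.mem_univ _)

section Relabel

variable {V W : Type*} (e : W ≃ V)

lemma IsDiClique.map_equiv {A : V → V → Prop} {s : Finset W}
    (hs : IsDiClique (fun x y => A (e x) (e y)) s) : IsDiClique A (s.map e.toEmbedding) := by
  intro x hx y hy hxy
  rw [Finset.mem_map_equiv] at hx hy
  simpa using hs _ hx _ hy (by simpa using hxy)

lemma wins_relabel {S : V → (V → Bool) → Option Bool} (c : W → Bool) :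
    Wins (fun w c => S (e w) (c ∘ e.symm)) c ↔ Wins S (c ∘ e.symm) := by
  simp [Wins, e.forall_congr_left, e.exists_congr_left]

lemma chance_relabel [Fintype V] [Fintype W] (S : V → (V → Bool) → Option Bool) :
    chance (fun w c => S (e w) (c ∘ e.symm)) = chance S := by
  have h : {c | Wins (fun w c => S (e w) (c ∘ e.symm)) c} =
      e.arrowCongr (Equiv.refl Bool) ⁻¹' {c | Wins S c} := by
    ext c
    exact wins_relabel e c
  rw [chance, chance, h, Set.ncard_preimage_of_injective_subset_range (Equiv.injective _) (by simp),
    Fintype.card_congr e]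

end Relabel

/-- For every `m ≥ 1` and `ε > 0` there exists a digraph `D` with `ω(D) = m` and
`h(D) > m/(m+1) - ε`. -/
theorem exists_digraph_cliqueNum_hatNumber_gt (m : ℕ) (hm : 1 ≤ m) (ε : ℚ) (hε : 0 < ε) :
    ∃ (n : ℕ) (A : Fin n → Fin n → Prop), Irreflexive A ∧ cliqueNum A = m ∧
      (m : ℚ) / ((m : ℚ) + 1) - ε < hatNumber A := by
  have hq1 : (1 - (m + 1) / 2 ^ m : ℚ) < 1 := by
    have : (0 : ℚ) < (m + 1) / 2 ^ m := by positivity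
    linarith
  have hq0 : (0 : ℚ) ≤ 1 - (m + 1) / 2 ^ m := by
    rw [sub_nonneg, div_le_one (by positivity)]
    exact_mod_cast Nat.lt_two_pow_self (n := m)
  obtain ⟨k, hk⟩ := exists_pow_lt_of_lt_one hε hq1
  have hk' := (pow_le_pow_of_le_one hq0 hq1.le k.le_succ).trans_lt hk
  obtain ⟨V, _, A, S, hirr, hle, hex, hS, hW, hQ⟩ := exists_iterated_union m hm (k + 1)
  let e := (Fintype.equivFin V).symm
  refine ⟨Fintype.card V, fun x y => A (e x) (e y), fun x => hirr (e x),
    cliqueNum_eq (fun s hs => ?_) ?_, ?_⟩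
  · simpa using hle _ (hs.map_equiv e)
  · obtain ⟨s, hs, hsc⟩ := hex k.succ_pos
    refine ⟨s.map e.symm.toEmbedding, IsDiClique.map_equiv e.symm ?_, by simpa using hsc⟩
    simpa using hs
  · have hS' : IsStrategy (fun x y => A (e x) (e y)) fun w c => S (e w) (c ∘ e.symm) :=
      fun w c c' h => hS (e w) _ _ fun u hu => h (e.symm u) (by simpa using hu)
    refine lt_of_lt_of_le ?_ (chance_le_hatNumber hS')
    rw [chance_relabel, chance, lt_div_iff₀ (by positivity)]
    set q : ℚ := (1 - (m + 1) / 2 ^ m) ^ (k + 1)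
    have hN : (0 : ℚ) < 2 ^ Fintype.card V := by positivity
    have hval : ({c | Wins S c}.ncard : ℚ) =
        m / (m + 1) * (1 - q) * 2 ^ Fintype.card V := by
      rw [hQ] at hW
      field_simp
      linear_combination hW
    rw [hval]
    have hf0 : (0 : ℚ) < m / (m + 1) := by positivity
    have hf1 : (m / (m + 1) : ℚ) < 1 := by
      rw [div_lt_one (by positivity)]
      linarith
    have hqnn : 0 ≤ q := pow_nonneg hq0 _
    gcongr
    nlinarith

end HatProblem
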